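/- Let R be a one-dimensional Cohen-Macaulay semi-local Arf ring and M a finitely generated reflexive R-module of positive rank. Set A = tr_R(M) : tr_R(M) ⊆ Q(R), and equip M with the unique A-module structure extending its R-module structure. Then tr_A(M) = A, and A is isomorphic to tr_R(M) as an R-module. -/

import Mathlib

open scoped TensorProduct

set_option synthInstance.maxHeartbeats 1000000
set_option maxHeartbeats 4000000

/-- The trace ideal of an `R`-module `M`: the sum of the images of all
`R`-linear maps `M → R`. -/
def traceIdeal (R : Type*) [CommRing R] (M : Type*) [AddCommGroup M] [Module R M] : Ideal R :=
  ⨆ f : M →ₗ[R] R, LinearMap.range f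

/-- `x` is integral over the ideal `I`: there are `n ≥ 1` and `a_i ∈ I^i` with
`x^n + a_1 x^{n-1} + ... + a_n = 0`. -/
def IsIntegralOverIdeal {R : Type*} [CommRing R] (I : Ideal R) (x : R) : Prop :=
  ∃ n : ℕ, 0 < n ∧ ∃ a : ℕ → R, (∀ i, 1 ≤ i → i ≤ n → a i ∈ I ^ i) ∧
    x ^ n + ∑ i ∈ Finset.Icc 1 n, a i * x ^ (n - i) = 0

/-- An ideal is integrally closed if it contains every element integral over it. -/
def IsIntegrallyClosedIdeal {R : Type*} [CommRing R] (I : Ideal R) : Prop :=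
  ∀ x : R, IsIntegralOverIdeal I x → x ∈ I

/-- A ring `R` is an Arf ring if for every integrally closed ideal `I` of `R` containing a
nonzerodivisor there exists `a ∈ I` with `I² = aI`. -/
def IsArfRing (R : Type*) [CommRing R] : Prop :=
  ∀ I : Ideal R, IsIntegrallyClosedIdeal I → (∃ x ∈ I, x ∈ nonZeroDivisors R) →
    ∃ a ∈ I, I ^ 2 = Ideal.span {a} * I

/-- A one-dimensional Cohen-Macaulay semi-local ring: a commutative Noetherian ring with
finitely many maximal ideals, all of whose localizations at maximal ideals are Noetherian
local rings of Krull dimension one whose maximal ideal contains a nonzerodivisor. -/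
def IsOneDimCMSemiLocal (R : Type*) [CommRing R] : Prop :=
  IsNoetherianRing R ∧ {I : Ideal R | I.IsMaximal}.Finite ∧
  ∀ m : Ideal R, (hm : m.IsMaximal) →
    letI := hm.isPrime
    ringKrullDim (Localization.AtPrime m) = 1 ∧
    ∃ x ∈ IsLocalRing.maximalIdeal (Localization.AtPrime m),
      x ∈ nonZeroDivisors (Localization.AtPrime m)

/-- The image of an ideal of `R` in the total ring of fractions `Q(R)`,
as an `R`-submodule of `Q(R)`. -/
noncomputable def idealImage {R : Type*} [CommRing R] (I : Ideal R) :
    Submodule R (FractionRing R) :=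
  Submodule.map (Algebra.linearMap R (FractionRing R)) I

section ArfSubalgebras

variable {R Q : Type*} [CommRing R] [CommRing Q] [Algebra R Q]

/-- `x` satisfies an equation of integral dependence over the `R`-submodule `J` of `Q`. -/
def IsIntegralOverSubmodule (J : Submodule R Q) (x : Q) : Prop :=
  ∃ n : ℕ, 0 < n ∧ ∃ a : ℕ → Q, (∀ i, 1 ≤ i → i ≤ n → a i ∈ J ^ i) ∧
    x ^ n + ∑ i ∈ Finset.Icc 1 n, a i * x ^ (n - i) = 0

theorem IsIntegralOverSubmodule.mono {J K : Submodule R Q} (h : J ≤ K) {x : Q}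
    (hx : IsIntegralOverSubmodule J x) : IsIntegralOverSubmodule K x := by
  obtain ⟨n, hn, a, ha, hsum⟩ := hx
  exact ⟨n, hn, a, fun i h1 h2 ↦ pow_le_pow_left' h i (ha i h1 h2), hsum⟩

/-- Dividing an integral equation over `a • J` by a power of the unit `a`. -/
theorem IsIntegralOverSubmodule.of_mul {J : Submodule R Q} {a x : Q} (ha : IsUnit a)
    (h : IsIntegralOverSubmodule (Submodule.span R {a} * J) (a * x)) :
    IsIntegralOverSubmodule J x := by
  obtain ⟨n, hn, c, hc, hsum⟩ := h
  have key : ∀ i, 1 ≤ i → i ≤ n → ∃ z ∈ J ^ i, a ^ i * z = c i := by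
    intro i h1 h2
    have := hc i h1 h2
    rwa [mul_pow, Submodule.span_pow, Set.singleton_pow, Submodule.mem_span_singleton_mul] at this
  choose! z hz hza using key
  refine ⟨n, hn, z, hz, ?_⟩
  apply (ha.pow n).mul_left_cancel
  rw [mul_zero, ← hsum, mul_add, mul_pow, Finset.mul_sum]
  congr 1
  refine Finset.sum_congr rfl fun i hi ↦ ?_
  obtain ⟨h1, h2⟩ := Finset.mem_Icc.mp hi
  rw [← hza i h1 h2, mul_pow, ← Nat.add_sub_cancel' h2, pow_add]
  simp only [Nat.add_sub_cancel_left]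
  ring

/-- An `R`-submodule of `Q` which is an ideal of the subalgebra `B` and contains a unit of `Q`. -/
structure Subalgebra.IsRegularIdeal (B : Subalgebra R Q) (J : Submodule R Q) : Prop where
  mem_of_mem : ∀ x ∈ J, x ∈ B
  mul_mem : ∀ b ∈ B, ∀ x ∈ J, b * x ∈ J
  exists_isUnit : ∃ v ∈ J, IsUnit v

/-- Every integrally closed regular ideal `J` of `B` is stable: `J² = aJ` for some `a ∈ J`. -/
def Subalgebra.IsArf (B : Subalgebra R Q) : Prop :=
  ∀ J : Submodule R Q, B.IsRegularIdeal J →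
    (∀ x ∈ B, IsIntegralOverSubmodule J x → x ∈ J) →
    ∃ a ∈ J, ∀ x ∈ J, ∀ y ∈ J, ∃ z ∈ J, x * y = a * z

theorem Subalgebra.IsRegularIdeal.pow_le {B : Subalgebra R Q} {J : Submodule R Q}
    (hJ : B.IsRegularIdeal J) {i : ℕ} (hi : 1 ≤ i) : J ^ i ≤ J := by
  induction i, hi using Nat.le_induction with
  | base => rw [pow_one]
  | succ k _ ih =>
    rw [pow_succ, Submodule.mul_le]
    exact fun x hx y hy ↦ hJ.mul_mem x (hJ.mem_of_mem x (ih hx)) y hy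

/-- A proper regular ideal is contained in a proper integrally closed one. -/
theorem Subalgebra.IsRegularIdeal.exists_integrallyClosed {B : Subalgebra R Q}
    {J : Submodule R Q} (hJ : B.IsRegularIdeal J) (h1 : (1 : Q) ∉ J) :
    ∃ m : Submodule R Q, J ≤ m ∧ B.IsRegularIdeal m ∧ (1 : Q) ∉ m ∧
      ∀ x ∈ B, IsIntegralOverSubmodule m x → x ∈ m := by
  let I : Ideal B :=
    { carrier := {b | (b : Q) ∈ J}
      add_mem' := fun ha hb ↦ J.add_mem ha hb
      zero_mem' := J.zero_mem
      smul_mem' := fun c x hx ↦ hJ.mul_mem c c.2 x hx }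
  obtain ⟨p, hp, hIp⟩ := Ideal.exists_le_maximal I
    (fun h ↦ h1 ((Ideal.eq_top_iff_one I).mp h))
  let m : Submodule R Q := (p.restrictScalars R).map B.val.toLinearMap
  have hmem : ∀ x : B, (x : Q) ∈ m ↔ x ∈ p := by
    intro x
    constructor
    · rintro ⟨y, hy, hyx⟩
      have : y = x := Subtype.ext hyx
      exact this ▸ hy
    · exact fun hx ↦ ⟨x, hx, rfl⟩
  have hmB : ∀ x ∈ m, x ∈ B := by
    rintro _ ⟨y, -, rfl⟩
    exact y.2
  have hJm : J ≤ m := fun x hx ↦ (hmem ⟨x, hJ.mem_of_mem x hx⟩).mpr (hIp hx)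
  have hm : B.IsRegularIdeal m :=
    { mem_of_mem := hmB
      mul_mem := fun b hb x hx ↦ (hmem (⟨b, hb⟩ * ⟨x, hmB x hx⟩)).mpr
        (p.mul_mem_left _ ((hmem ⟨x, hmB x hx⟩).mp hx))
      exists_isUnit := let ⟨v, hv, hu⟩ := hJ.exists_isUnit; ⟨v, hJm hv, hu⟩ }
  refine ⟨m, hJm, hm, fun h ↦ hp.ne_top ((Ideal.eq_top_iff_one p).mpr ((hmem 1).mp h)), ?_⟩
  rintro x hxB ⟨n, -, a, ha, hsum⟩
  have hxn : x ^ n ∈ m := by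
    rw [eq_neg_of_add_eq_zero_left hsum]
    refine m.neg_mem (m.sum_mem fun i hi ↦ ?_)
    obtain ⟨h1, h2⟩ := Finset.mem_Icc.mp hi
    rw [mul_comm]
    exact hm.mul_mem _ (pow_mem hxB _) _ (hm.pow_le h1 (ha i h1 h2))
  exact (hmem ⟨x, hxB⟩).mpr (hp.isPrime.mem_of_pow_mem n ((hmem (⟨x, hxB⟩ ^ n)).mp hxn))

/-- Blowing up a proper regular ideal of an Arf subalgebra: the ideal enlarges to a proper ideal
`m` such that `a⁻¹ m = m : m` is again an Arf subalgebra. -/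
theorem Subalgebra.IsArf.exists_blowup {B : Subalgebra R Q} (hB : B.IsArf)
    {J : Submodule R Q} (hJ : B.IsRegularIdeal J) (h1 : (1 : Q) ∉ J) :
    ∃ (m : Submodule R Q) (a : Q) (B' : Subalgebra R Q), J ≤ m ∧ B.IsRegularIdeal m ∧
      (1 : Q) ∉ m ∧ a ∈ m ∧ IsUnit a ∧ B ≤ B' ∧ B'.IsArf ∧ (∀ x, x ∈ B' ↔ a * x ∈ m) ∧
      ∀ x ∈ B', ∀ y ∈ m, x * y ∈ m := by
  obtain ⟨m, hJm, hm, h1m, hclosed⟩ := hJ.exists_integrallyClosed h1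
  obtain ⟨a, ham, hstable⟩ := hB m hm hclosed
  have hau : IsUnit a := by
    obtain ⟨v, hv, hvu⟩ := hm.exists_isUnit
    obtain ⟨z, -, hz⟩ := hstable v hv v hv
    exact isUnit_of_mul_isUnit_left (hz ▸ hvu.mul hvu)
  let B' : Subalgebra R Q :=
    { carrier := {x | ∀ y ∈ m, x * y ∈ m}
      mul_mem' := fun {x y} hx hy z hz ↦ by rw [mul_assoc]; exact hx _ (hy z hz)
      add_mem' := fun {x y} hx hy z hz ↦ by rw [add_mul]; exact m.add_mem (hx z hz) (hy z hz)
      algebraMap_mem' := fun r y hy ↦ hm.mul_mem _ (B.algebraMap_mem r) y hy }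
  have hB' : ∀ x, x ∈ B' ↔ a * x ∈ m := by
    intro x
    constructor
    · intro hx
      rw [mul_comm]
      exact hx a ham
    · intro hx y hy
      obtain ⟨z, hz, hxyz⟩ := hstable (a * x) hx y hy
      rw [mul_assoc] at hxyz
      rwa [hau.mul_left_cancel hxyz]
  refine ⟨m, a, B', hJm, hm, h1m, ham, hau, fun b hb y hy ↦ hm.mul_mem b hb y hy, ?_, hB',
    fun x hx ↦ hx⟩
  intro K hK hKclosed
  have hKm : Submodule.span R {a} * K ≤ m := by
    intro x hx
    obtain ⟨z, hz, rfl⟩ := Submodule.mem_span_singleton_mul.mp hx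
    exact (hB' z).mp (hK.mem_of_mem z hz)
  have hBB' : ∀ b ∈ B, b ∈ B' := fun b hb y hy ↦ hm.mul_mem b hb y hy
  have haK : B.IsRegularIdeal (Submodule.span R {a} * K) :=
    { mem_of_mem := fun x hx ↦ hm.mem_of_mem x (hKm hx)
      mul_mem := by
        intro b hb x hx
        obtain ⟨z, hz, rfl⟩ := Submodule.mem_span_singleton_mul.mp hx
        exact Submodule.mem_span_singleton_mul.mpr
          ⟨b * z, hK.mul_mem b (hBB' b hb) z hz, mul_left_comm a b z⟩
      exists_isUnit := by
        obtain ⟨v, hv, hvu⟩ := hK.exists_isUnit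
        exact ⟨a * v, Submodule.mem_span_singleton_mul.mpr ⟨v, hv, rfl⟩, hau.mul hvu⟩ }
  obtain ⟨b, hb, hbK⟩ := hB _ haK (by
    intro x hxB hx
    obtain ⟨y, rfl⟩ : ∃ y, a * y = x := by
      obtain ⟨c, hc⟩ := hau.exists_right_inv
      exact ⟨c * x, by rw [← mul_assoc, hc, one_mul]⟩
    have hym : a * y ∈ m := hclosed _ hxB (hx.mono hKm)
    exact Submodule.mem_span_singleton_mul.mpr
      ⟨y, hKclosed y ((hB' y).mpr hym) (hx.of_mul hau), rfl⟩)
  obtain ⟨j, hj, rfl⟩ := Submodule.mem_span_singleton_mul.mp hb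
  refine ⟨j, hj, fun x hx y hy ↦ ?_⟩
  obtain ⟨z, hz, hxyz⟩ := hbK (a * x) (Submodule.mem_span_singleton_mul.mpr ⟨x, hx, rfl⟩)
    (a * y) (Submodule.mem_span_singleton_mul.mpr ⟨y, hy, rfl⟩)
  obtain ⟨w, hw, rfl⟩ := Submodule.mem_span_singleton_mul.mp hz
  refine ⟨w, hw, (hau.mul hau).mul_left_cancel ?_⟩
  linear_combination hxyz

/-- A unit of `Q` lying in `B` whose inverse lies in a Noetherian overring is invertible in `B`. -/
theorem Subalgebra.inv_mem_of_isNoetherian {A B : Subalgebra R Q} [IsNoetherian R A]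
    (hBA : B ≤ A) {a b : Q} (ha : a ∈ B) (hb : b ∈ A) (hab : a * b = 1) : b ∈ B := by
  have hint : (inclusion hBA).toRingHom.IsIntegral := by
    refine RingHom.IsIntegral.tower_top (algebraMap R B) _ fun x ↦ ?_
    exact IsIntegral.of_finite R x
  have := hint.isLocalHom (inclusion_injective hBA)
  have hunit : IsUnit (⟨a, ha⟩ : B) := isUnit_of_map_unit (inclusion hBA).toRingHom _
    (IsUnit.of_mul_eq_one (⟨b, hb⟩ : A) (Subtype.ext hab))
  obtain ⟨c, hc⟩ := hunit.exists_right_inv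
  have hac : a * c = 1 := congrArg Subtype.val hc
  rw [left_inv_eq_right_inv ((mul_comm b a).trans hab) hac]
  exact c.2

/-- If `B` is Arf and `A ⊇ B` is Noetherian and reflexive over `B`, then `B : A` is principal
over `A`. -/
theorem Subalgebra.IsArf.exists_colon_eq {A B₀ : Subalgebra R Q} [IsNoetherian R A]
    (hB₀ : B₀.IsArf) (hle : B₀ ≤ A) (hunit : ∃ v, IsUnit v ∧ ∀ y ∈ A, v * y ∈ B₀)
    (hrefl : ∀ x, (∀ w, (∀ y ∈ A, w * y ∈ B₀) → x * w ∈ B₀) → x ∈ A) :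
    A.IsArf ∧ ∃ u, IsUnit u ∧ ∀ x, (∀ y ∈ A, x * y ∈ B₀) ↔ ∃ z ∈ A, x = u * z := by
  let S : Set (Subalgebra R Q) := {B | B.IsArf ∧ B ≤ A ∧
    (∃ v, IsUnit v ∧ ∀ y ∈ A, v * y ∈ B) ∧
    (∀ x, (∀ w, (∀ y ∈ A, w * y ∈ B) → x * w ∈ B) → x ∈ A) ∧
    ∃ u, IsUnit u ∧ ∀ x, (∀ y ∈ A, x * y ∈ B₀) ↔ ∃ z, (∀ y ∈ A, z * y ∈ B) ∧ x = u * z}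
  have hS : B₀ ∈ S := ⟨hB₀, hle, hunit, hrefl, 1, isUnit_one, by simp⟩
  let F : Subalgebra R Q → Submodule R A := fun B ↦ (toSubmodule B).comap A.val.toLinearMap
  obtain ⟨B, ⟨hB, hBA, ⟨v, hvu, hv⟩, hBrefl, u, hu, hcolon⟩, hmax⟩ :=
    (InvImage.wf F (wellFounded_gt (α := Submodule R A))).has_min S ⟨B₀, hS⟩
  have hAB : A ≤ B := by
    by_contra hAB
    let c : Submodule R Q := toSubmodule B / toSubmodule A
    have hc : ∀ x, x ∈ c ↔ ∀ y ∈ A, x * y ∈ B := fun x ↦ Submodule.mem_div_iff_forall_mul_mem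
    have hcA : ∀ x ∈ A, ∀ y ∈ c, x * y ∈ c := by
      intro x hx y hy
      rw [hc] at hy ⊢
      intro z hz
      rw [mul_right_comm, mul_comm]
      exact hy _ (A.mul_mem hx hz)
    have hcreg : B.IsRegularIdeal c :=
      { mem_of_mem := fun x hx ↦ by simpa using (hc x).mp hx 1 A.one_mem
        mul_mem := fun b hb ↦ hcA b (hBA hb)
        exists_isUnit := ⟨v, (hc v).mpr hv, hvu⟩ }
    obtain ⟨m, a, B', hcm, hm, h1m, ham, hau, hBB', hB', hB'mem, hB'mul⟩ := hB.exists_blowup hcreg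
      (fun h ↦ hAB fun y hy ↦ by simpa using (hc 1).mp h y hy)
    obtain ⟨b, hab⟩ := hau.exists_right_inv
    have hsub : ∀ x, (∀ w ∈ c, x * w ∈ B) → x ∈ A :=
      fun x hx ↦ hBrefl x fun w hw ↦ hx w ((hc w).mpr hw)
    have hB'A : B' ≤ A := fun x hx ↦
      hsub x fun w hw ↦ hm.mem_of_mem _ (hB'mul x hx w (hcm hw))
    have hc' : ∀ x, (∀ y ∈ A, x * y ∈ B') ↔ a * x ∈ c := by
      intro x
      constructor
      · intro hx
        rw [hc]
        intro y hy
        rw [mul_assoc]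
        exact hm.mem_of_mem _ ((hB'mem _).mp (hx y hy))
      · intro hx y hy
        rw [hB'mem, ← mul_assoc, mul_comm]
        exact hcm (hcA y hy _ hx)
    have hmul : ∀ w, a * (b * w) = w := fun w ↦ by rw [← mul_assoc, hab, one_mul]
    have hB'S : B' ∈ S := by
      refine ⟨hB', hB'A, ⟨b * v, ?_, ?_⟩, ?_, u * a, hu.mul hau, ?_⟩
      · exact (IsUnit.of_mul_eq_one a (by rw [mul_comm, hab])).mul hvu
      · rw [hc', hmul, hc]
        exact hv
      · intro x hx
        refine hsub x fun w hw ↦ ?_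
        have := (hB'mem _).mp (hx (b * w) ((hc' _).mpr (by rwa [hmul])))
        rw [mul_left_comm, hmul] at this
        exact hm.mem_of_mem _ this
      · intro x
        rw [hcolon]
        constructor
        · rintro ⟨z, hz, rfl⟩
          exact ⟨b * z, (hc' _).mpr (by rwa [hmul, hc]), by rw [mul_assoc, hmul]⟩
        · rintro ⟨z, hz, rfl⟩
          exact ⟨a * z, (hc _).mp ((hc' z).mp hz), by rw [mul_assoc]⟩
    have hB'B : B' ≤ B := by
      have hFle : F B ≤ F B' := fun x hx ↦ hBB' hx
      have : F B = F B' := hFle.eq_of_not_lt (hmax B' hB'S)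
      intro x hx
      exact this.ge (show (⟨x, hB'A hx⟩ : A) ∈ F B' from hx)
    have hbA : b ∈ A :=
      hsub b fun w hw ↦ hB'B ((hB'mem _).mpr (by rw [hmul]; exact hcm hw))
    have hbB : b ∈ B := inv_mem_of_isNoetherian hBA (hm.mem_of_mem a ham) hbA hab
    exact h1m (by rw [← hab, mul_comm]; exact hm.mul_mem b hbB a ham)
  obtain rfl : B = A := le_antisymm hBA hAB
  refine ⟨hB, u, hu, fun x ↦ (hcolon x).trans ?_⟩
  constructor
  · rintro ⟨z, hz, rfl⟩
    exact ⟨z, by simpa using hz 1 B.one_mem, rfl⟩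
  · rintro ⟨z, hz, rfl⟩
    exact ⟨z, fun y hy ↦ B.mul_mem hz hy, rfl⟩

end ArfSubalgebras

section FractionRing

variable {R : Type*} [CommRing R]

theorem mem_idealImage {I : Ideal R} {x : FractionRing R} :
    x ∈ idealImage I ↔ ∃ r ∈ I, algebraMap R (FractionRing R) r = x :=
  Iff.rfl

theorem isUnit_algebraMap_fractionRing_iff {r : R} :
    IsUnit (algebraMap R (FractionRing R) r) ↔ r ∈ nonZeroDivisors R := by
  refine ⟨fun h ↦ ?_, fun h ↦ IsLocalization.map_units (FractionRing R) ⟨r, h⟩⟩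
  rw [mem_nonZeroDivisors_iff_right]
  intro x hx
  apply IsFractionRing.injective R (FractionRing R)
  apply h.mul_right_cancel
  rw [← map_mul, hx, map_zero, zero_mul]

theorem algebraMap_mem_idealImage_pow {I : Ideal R} {i : ℕ} {r : R} (hr : r ∈ I ^ i) :
    algebraMap R (FractionRing R) r ∈ idealImage I ^ i := by
  have := Submodule.map_pow I (Algebra.ofId R (FractionRing R)) i
  exact this.le ⟨r, hr, rfl⟩

/-- An Arf ring is an Arf subalgebra of its total ring of fractions. -/
theorem IsArfRing.isArf_bot (hR : IsArfRing R) :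
    (⊥ : Subalgebra R (FractionRing R)).IsArf := by
  intro J hJ hclosed
  let I : Ideal R := J.comap (Algebra.linearMap R (FractionRing R))
  have hJI : ∀ x ∈ J, ∃ r ∈ I, algebraMap R (FractionRing R) r = x := by
    intro x hx
    obtain ⟨r, rfl⟩ := Algebra.mem_bot.mp (hJ.mem_of_mem x hx)
    exact ⟨r, hx, rfl⟩
  have hIJ : idealImage I ≤ J := Submodule.map_comap_le _ _
  obtain ⟨a, ha, hI⟩ := hR I (by
      rintro x ⟨n, hn, a, ha, hsum⟩
      refine hclosed _ (Subalgebra.algebraMap_mem _ x) (.mono hIJ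
        ⟨n, hn, fun i ↦ algebraMap R _ (a i), fun i h1 h2 ↦
          algebraMap_mem_idealImage_pow (ha i h1 h2), ?_⟩)
      simpa using congrArg (algebraMap R (FractionRing R)) hsum) (by
      obtain ⟨v, hv, hvu⟩ := hJ.exists_isUnit
      obtain ⟨r, hr, rfl⟩ := hJI v hv
      exact ⟨r, hr, isUnit_algebraMap_fractionRing_iff.mp hvu⟩)
  refine ⟨algebraMap R _ a, ha, fun x hx y hy ↦ ?_⟩
  obtain ⟨r, hr, rfl⟩ := hJI x hx
  obtain ⟨s, hs, rfl⟩ := hJI y hy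
  have hrs : r * s ∈ Ideal.span {a} * I := by
    rw [← hI, pow_two]
    exact Ideal.mul_mem_mul hr hs
  obtain ⟨z, hz, hazrs⟩ := Ideal.mem_span_singleton_mul.mp hrs
  exact ⟨algebraMap R _ z, hz, by rw [← map_mul, ← map_mul, hazrs]⟩

variable {M : Type*} [AddCommGroup M] [Module R M]

theorem apply_mem_traceIdeal (f : M →ₗ[R] R) (m : M) : f m ∈ traceIdeal R M :=
  (le_iSup (fun f : M →ₗ[R] R ↦ LinearMap.range f) f) ⟨m, rfl⟩

theorem traceIdeal_le {I : Ideal R} (h : ∀ (f : M →ₗ[R] R) (m : M), f m ∈ I) :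
    traceIdeal R M ≤ I :=
  iSup_le fun f ↦ by rintro _ ⟨m, rfl⟩; exact h f m

/-- The trace ideal of a finitely presented module of positive rank is regular. -/
theorem exists_mem_traceIdeal_mem_nonZeroDivisors [Module.FinitePresentation R M]
    [Module.Free (FractionRing R) (FractionRing R ⊗[R] M)]
    (hrank : 0 < Module.rank (FractionRing R) (FractionRing R ⊗[R] M)) :
    ∃ r ∈ traceIdeal R M, r ∈ nonZeroDivisors R := by
  cases subsingleton_or_nontrivial (FractionRing R) with
  | inl h =>
    have := (IsFractionRing.injective R (FractionRing R)).subsingleton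
    exact ⟨0, zero_mem _,
      mem_nonZeroDivisors_iff_right.mpr fun _ _ ↦ Subsingleton.elim _ _⟩
  | inr h =>
    let b := Module.Free.chooseBasis (FractionRing R) (FractionRing R ⊗[R] M)
    have hne : Nonempty
        (Module.Free.ChooseBasisIndex (FractionRing R) (FractionRing R ⊗[R] M)) := by
      rw [← Cardinal.mk_ne_zero_iff, b.mk_eq_rank'']
      exact hrank.ne'
    obtain ⟨i⟩ := hne
    let ι := TensorProduct.mk R (FractionRing R) M 1
    obtain ⟨f, s, hf⟩ := Module.FinitePresentation.exists_lift_of_isLocalizedModule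
      (nonZeroDivisors R) (Algebra.linearMap R (FractionRing R))
      ((b.coord i).restrictScalars R ∘ₗ ι)
    obtain ⟨⟨m, t⟩, hm⟩ := IsLocalizedModule.surj (nonZeroDivisors R) ι (b i)
    have hfm : f m = s * t := by
      apply IsFractionRing.injective R (FractionRing R)
      have h1 := LinearMap.congr_fun hf m
      simp only [LinearMap.comp_apply, LinearMap.smul_apply, LinearMap.restrictScalars_apply] at h1
      rw [← hm] at h1
      simpa [Submonoid.smul_def, Algebra.smul_def] using h1
    exact ⟨f m, apply_mem_traceIdeal f m, hfm ▸ mul_mem s.2 t.2⟩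

/-- Linear maps from a module over an overring `A` of `R` inside the total ring of fractions
are automatically `A`-linear. -/
theorem map_smul_of_mem_fractionRing {A : Subalgebra R (FractionRing R)} [Module A M]
    [IsScalarTower R A M] (f : M →ₗ[R] FractionRing R) (x : A) (m : M) :
    f (x • m) = x * f m := by
  obtain ⟨⟨r, s⟩, hrs⟩ := IsLocalization.surj (nonZeroDivisors R) (x : FractionRing R)
  apply (IsLocalization.map_units (FractionRing R) s).mul_left_cancel
  have hsx : (s : R) • x = algebraMap R A r := by
    apply Subtype.ext
    rw [mul_comm] at hrs
    simpa [Algebra.smul_def] using hrs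
  rw [← Algebra.smul_def, ← map_smul, ← smul_assoc, hsx, algebraMap_smul, map_smul,
    Algebra.smul_def, ← mul_assoc, mul_comm _ (x : FractionRing R), hrs]

/-- A linear map to the total ring of fractions with values in `R` factors through `R`. -/
theorem exists_algebraMap_comp_eq (g : M →ₗ[R] FractionRing R)
    (hg : ∀ m, g m ∈ (⊥ : Subalgebra R (FractionRing R))) :
    ∃ f : M →ₗ[R] R, ∀ m, algebraMap R (FractionRing R) (f m) = g m := by
  let e := LinearEquiv.ofInjective (Algebra.linearMap R (FractionRing R))
    (IsFractionRing.injective R (FractionRing R))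
  let g' := g.codRestrict (LinearMap.range (Algebra.linearMap R (FractionRing R)))
    fun m ↦ Algebra.mem_bot.mp (hg m)
  refine ⟨e.symm.toLinearMap ∘ₗ g', fun m ↦ ?_⟩
  exact congrArg Subtype.val (e.apply_symm_apply (g' m))

theorem mul_mem_idealImage_traceIdeal {x : FractionRing R}
    (hx : ∀ y ∈ idealImage (traceIdeal R M), x * y ∈ (⊥ : Subalgebra R (FractionRing R))) :
    ∀ y ∈ idealImage (traceIdeal R M), x * y ∈ idealImage (traceIdeal R M) := by
  suffices traceIdeal R M ≤ (idealImage (traceIdeal R M)).comap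
      (LinearMap.mulLeft R x ∘ₗ Algebra.linearMap R (FractionRing R)) by
    rintro _ ⟨r, hr, rfl⟩
    exact this hr
  refine traceIdeal_le fun f m ↦ ?_
  obtain ⟨f', hf'⟩ := exists_algebraMap_comp_eq
    (LinearMap.mulLeft R x ∘ₗ Algebra.linearMap R (FractionRing R) ∘ₗ f)
    fun m ↦ hx _ ⟨f m, apply_mem_traceIdeal f m, rfl⟩
  exact ⟨f' m, apply_mem_traceIdeal f' m, hf' m⟩

/-- If `A = tr(M) : tr(M)` acts on `M`, and `R` is a Noetherian Arf ring, then `tr_A(M) = A`, and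
`tr(M)` is principal over `A`. -/
theorem IsArfRing.traceIdeal_eq_top_and_exists [IsNoetherianRing R] (hArf : IsArfRing R)
    {A : Subalgebra R (FractionRing R)} [Module A M] [IsScalarTower R A M]
    (hA : Subalgebra.toSubmodule A = idealImage (traceIdeal R M) / idealImage (traceIdeal R M))
    (hreg : ∃ r ∈ traceIdeal R M, r ∈ nonZeroDivisors R) :
    traceIdeal A M = ⊤ ∧ ∃ u, IsUnit u ∧
      ∀ y, y ∈ idealImage (traceIdeal R M) ↔ ∃ z ∈ A, y = u * z := by
  set I := idealImage (traceIdeal R M)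
  have hmemA : ∀ x, x ∈ A ↔ ∀ y ∈ I, x * y ∈ I := by
    intro x
    rw [← Subalgebra.mem_toSubmodule, hA, Submodule.mem_div_iff_forall_mul_mem]
  have hcolonA : ∀ x, (∀ y ∈ I, x * y ∈ (⊥ : Subalgebra R (FractionRing R))) → x ∈ A :=
    fun x hx ↦ (hmemA x).mpr (mul_mem_idealImage_traceIdeal hx)
  have hIR : ∀ y ∈ I, y ∈ (⊥ : Subalgebra R (FractionRing R)) := by
    rintro _ ⟨r, -, rfl⟩
    exact Subalgebra.algebraMap_mem _ r
  obtain ⟨ρ, hρI, hρ⟩ : ∃ ρ ∈ I, IsUnit ρ := by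
    obtain ⟨r, hr, hr'⟩ := hreg
    exact ⟨_, ⟨r, hr, rfl⟩, isUnit_algebraMap_fractionRing_iff.mpr hr'⟩
  have hIA : ∀ y ∈ I, ∀ x ∈ A, y * x ∈ I := by
    intro y hy x hx
    rw [mul_comm]
    exact (hmemA x).mp hx y hy
  have : IsNoetherian R A := by
    let φ : A →ₗ[R] LinearMap.range (Algebra.linearMap R (FractionRing R)) :=
      (LinearMap.mulLeft R ρ ∘ₗ A.val.toLinearMap).codRestrict _
        fun x ↦ Algebra.mem_bot.mp (hIR _ (hIA ρ hρI x x.2))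
    refine isNoetherian_of_injective φ fun x y hxy ↦ Subtype.ext ?_
    exact hρ.mul_left_cancel (congrArg Subtype.val hxy)
  obtain ⟨hAArf, u, hu, hcolon⟩ := hArf.isArf_bot.exists_colon_eq (A := A) bot_le
    ⟨ρ, hρ, fun y hy ↦ hIR _ (hIA ρ hρI y hy)⟩
    (fun x hx ↦ hcolonA x fun y hy ↦ hx y fun z hz ↦ hIR _ (hIA y hy z hz))
  obtain ⟨v, huv⟩ := hu.exists_right_inv
  have huA : ∀ z ∈ A, u * z ∈ (⊥ : Subalgebra R (FractionRing R)) := fun z hz ↦ by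
    simpa using (hcolon (u * z)).mpr ⟨z, hz, rfl⟩ 1 A.one_mem
  have hItrace : ∀ y ∈ I, ∃ t ∈ traceIdeal A M, y = u * t := by
    suffices traceIdeal R M ≤
        (((traceIdeal A M).restrictScalars R).map A.val.toLinearMap).comap
          (LinearMap.mulLeft R v ∘ₗ Algebra.linearMap R (FractionRing R)) by
      rintro _ ⟨r, hr, rfl⟩
      obtain ⟨t, ht, htr⟩ := this hr
      refine ⟨t, ht, ?_⟩
      have htr' : (t : FractionRing R) = v * algebraMap R _ r := htr
      rw [htr', ← mul_assoc, huv, one_mul]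
      rfl
    refine traceIdeal_le fun f m ↦ ?_
    have hvA : ∀ m, v * algebraMap R (FractionRing R) (f m) ∈ A := by
      intro m
      obtain ⟨z, hz, hfz⟩ := (hcolon (algebraMap R _ (f m))).mp
        fun y hy ↦ hIR _ (hIA _ ⟨f m, apply_mem_traceIdeal f m, rfl⟩ y hy)
      rwa [hfz, ← mul_assoc, mul_comm v, huv, one_mul]
    let φ := LinearMap.mulLeft R v ∘ₗ Algebra.linearMap R (FractionRing R) ∘ₗ f
    let g : M →ₗ[A] A :=
      { toFun := fun m ↦ ⟨φ m, hvA m⟩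
        map_add' := fun x y ↦ Subtype.ext (map_add φ x y)
        map_smul' := fun x m ↦ Subtype.ext (map_smul_of_mem_fractionRing φ x m) }
    exact ⟨g m, apply_mem_traceIdeal g m, rfl⟩
  have htop : traceIdeal A M = ⊤ := by
    rw [Ideal.eq_top_iff_one]
    by_contra h1
    let T : Submodule R (FractionRing R) :=
      ((traceIdeal A M).restrictScalars R).map A.val.toLinearMap
    have hT : A.IsRegularIdeal T :=
      { mem_of_mem := by
          rintro _ ⟨t, -, rfl⟩
          exact t.2
        mul_mem := by
          rintro x hx _ ⟨t, ht, rfl⟩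
          exact ⟨⟨x, hx⟩ * t, (traceIdeal A M).mul_mem_left _ ht, rfl⟩
        exists_isUnit := by
          obtain ⟨t, ht, htρ⟩ := hItrace ρ hρI
          exact ⟨t, ⟨t, ht, rfl⟩, isUnit_of_mul_isUnit_right (htρ ▸ hρ)⟩ }
    obtain ⟨m, a, B', hTm, hm, h1m, ham, hau, -, -, hB', hB'mul⟩ := hAArf.exists_blowup hT (by
      rintro ⟨t, ht, ht1⟩
      exact h1 ((show t = 1 from Subtype.ext ht1) ▸ ht))
    have hTcolon : ∀ x, (∀ t ∈ T, x * t ∈ A) → x ∈ A := by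
      refine fun x hx ↦ hcolonA x fun y hy ↦ ?_
      obtain ⟨t, ht, rfl⟩ := hItrace y hy
      rw [mul_left_comm]
      exact huA _ (hx t ⟨t, ht, rfl⟩)
    have hB'A : ∀ x ∈ B', x ∈ A :=
      fun x hx ↦ hTcolon x fun t ht ↦ hm.mem_of_mem _ (hB'mul x hx t (hTm ht))
    obtain ⟨b, hab⟩ := hau.exists_right_inv
    have hbA : b ∈ A := hTcolon b fun t ht ↦ hB'A _ ((hB' _).mpr (by
      rw [← mul_assoc, hab, one_mul]
      exact hTm ht))
    exact h1m (by rw [← hab, mul_comm]; exact hm.mul_mem b hbA a ham)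
  refine ⟨htop, u, hu, fun y ↦ ⟨fun hy ↦ ?_, ?_⟩⟩
  · obtain ⟨t, -, rfl⟩ := hItrace y hy
    exact ⟨t, t.2, rfl⟩
  · rintro ⟨z, hz, rfl⟩
    let K : Ideal A :=
      { carrier := {z | u * z ∈ I}
        add_mem' := fun {x y} hx hy ↦ by
          simpa only [Set.mem_ofPred_eq, Subalgebra.coe_add, mul_add] using I.add_mem hx hy
        zero_mem' := by simp
        smul_mem' := fun c x hx ↦ by
          have := (hmemA c).mp c.2 _ hx
          rwa [mul_left_comm] at this }
    have hK : traceIdeal A M ≤ K := by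
      refine traceIdeal_le fun g m ↦ ?_
      obtain ⟨f, hf⟩ := exists_algebraMap_comp_eq
        (LinearMap.mulLeft R u ∘ₗ A.val.toLinearMap ∘ₗ g.restrictScalars R)
        fun m ↦ huA _ (g m).2
      exact ⟨f m, apply_mem_traceIdeal f m, hf m⟩
    exact hK (htop ▸ Submodule.mem_top : (⟨z, hz⟩ : A) ∈ traceIdeal A M)

end FractionRing

/-- Let `R` be a one-dimensional Cohen-Macaulay semi-local Arf ring and `M` a finitely
generated reflexive `R`-module of positive rank. Set `A = tr_R(M) : tr_R(M) ⊆ Q(R)`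
(an `R`-subalgebra of `Q(R)`), and equip `M` with the unique `A`-module structure
extending its `R`-module structure. Then `tr_A(M) = A`, and `A` is isomorphic to
`tr_R(M)` as an `R`-module. -/
theorem trace_over_colon_algebra {R : Type} [CommRing R]
    (hR : IsOneDimCMSemiLocal R) (hArf : IsArfRing R)
    (M : Type) [AddCommGroup M] [Module R M] [Module.Finite R M] [Module.IsReflexive R M]
    [Module.Free (FractionRing R) (FractionRing R ⊗[R] M)]
    (hrank : 0 < Module.rank (FractionRing R) (FractionRing R ⊗[R] M))
    (A : Subalgebra R (FractionRing R))
    (hA : Subalgebra.toSubmodule A = idealImage (traceIdeal R M) / idealImage (traceIdeal R M))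
    (inst : Module ↥A M)
    (hcomp : ∀ (r : R) (m : M), (letI := inst; (algebraMap R ↥A r) • m) = r • m) :
    (letI := inst; traceIdeal ↥A M = ⊤) ∧
    Nonempty (↥A ≃ₗ[R] ↥(traceIdeal R M)) := by
  let := inst
  have : IsNoetherianRing R := hR.1
  have : IsScalarTower R A M := ⟨fun r x m ↦ by
    rw [Algebra.smul_def, mul_smul, hcomp]⟩
  have : Module.FinitePresentation R M := Module.finitePresentation_of_finite R M
  obtain ⟨htop, u, hu, hmem⟩ := hArf.traceIdeal_eq_top_and_exists hA
    (exists_mem_traceIdeal_mem_nonZeroDivisors hrank)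
  refine ⟨htop, ⟨?_⟩⟩
  let φ : A →ₗ[R] FractionRing R := LinearMap.mulLeft R u ∘ₗ A.val.toLinearMap
  have hφ : Function.Injective φ := fun x y hxy ↦ Subtype.ext (hu.mul_left_cancel hxy)
  have hrange : LinearMap.range φ = idealImage (traceIdeal R M) := by
    ext y
    rw [hmem]
    exact ⟨fun ⟨x, hx⟩ ↦ ⟨x, x.2, hx.symm⟩, fun ⟨z, hz, hy⟩ ↦ ⟨⟨z, hz⟩, hy.symm⟩⟩
  exact (LinearEquiv.ofInjective φ hφ).trans ((LinearEquiv.ofEq _ _ hrange).trans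
    (Submodule.equivMapOfInjective _ (IsFractionRing.injective R (FractionRing R)) _).symm)
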